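/- Decomposition of the divergence of the Landau matrix through the Bessel potential (Proposition 3.1, identities (3.9) and bound (3.10)): let w₀ be a Schwartz function on ℝ³. Then for every v ∈ ℝ³: ∇_v · A[w₀](v) = ∇_v a[w₀](v) = A₁(v) + ∇_v(𝓜w₀)(v), where A₁(v) := (1/(4π)) ∇_v ∫_{ℝ³} (𝓜w₀)(v₁)/|v−v₁| dv₁ = ∇_v a[𝓜w₀](v). Moreover there is a universal constant C > 0 (independent of w₀) such that ‖A₁‖_{L⁶(ℝ³)} ≤ C ‖𝓜w₀‖_{L²(ℝ³)}. -/

import Mathlib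

open MeasureTheory Set
open scoped ENNReal

noncomputable section

/-- The Japanese bracket `⟨v⟩ = (1+|v|²)^(1/2)` on `ℝ³`. -/
def jap (v : EuclideanSpace ℝ (Fin 3)) : ℝ := Real.sqrt (1 + ‖v‖ ^ 2)

/-- Partial derivative in the `i`-th coordinate direction. -/
def pd (i : Fin 3) (φ : EuclideanSpace ℝ (Fin 3) → ℝ) (v : EuclideanSpace ℝ (Fin 3)) : ℝ :=
  fderiv ℝ φ v (EuclideanSpace.single i 1)

/-- Iterated partial derivative along a list of coordinate directions (a multi-index). -/
def pdMany : List (Fin 3) → (EuclideanSpace ℝ (Fin 3) → ℝ) → EuclideanSpace ℝ (Fin 3) → ℝ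
  | [], φ => φ
  | i :: l, φ => pd i (pdMany l φ)

/-- The projection kernel `P(z) = Id − z⊗z/|z|²`. -/
def Pker (z : EuclideanSpace ℝ (Fin 3)) (i j : Fin 3) : ℝ :=
  (if i = j then (1 : ℝ) else 0) - z i * z j / ‖z‖ ^ 2

/-- The Landau matrix `A[h](v) = (1/(8π)) ∫ (P(v−z)/|v−z|) h(z) dz` (entry `(i,j)`). -/
def LandauA (h : EuclideanSpace ℝ (Fin 3) → ℝ) (v : EuclideanSpace ℝ (Fin 3)) (i j : Fin 3) : ℝ :=
  (1 / (8 * Real.pi)) * ∫ z, Pker (v - z) i j / ‖v - z‖ * h z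

/-- The Landau potential `a[h](v) = (1/(4π)) ∫ h(z)/|v−z| dz`. -/
def landaua (h : EuclideanSpace ℝ (Fin 3) → ℝ) (v : EuclideanSpace ℝ (Fin 3)) : ℝ :=
  (1 / (4 * Real.pi)) * ∫ z, h z / ‖v - z‖

/-- The Bessel potential operator `𝓜 = (I − Δ)⁻¹` via its integral kernel. -/
def besselM (h : EuclideanSpace ℝ (Fin 3) → ℝ) (v : EuclideanSpace ℝ (Fin 3)) : ℝ :=
  (1 / (4 * Real.pi)) * ∫ z, Real.exp (-‖v - z‖) / ‖v - z‖ * h z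

/-- Squared euclidean norm of the gradient. -/
def gradNormSq (φ : EuclideanSpace ℝ (Fin 3) → ℝ) (v : EuclideanSpace ℝ (Fin 3)) : ℝ :=
  ∑ i, (pd i φ v) ^ 2

/-- Euclidean norm of the gradient. -/
def gradNorm (φ : EuclideanSpace ℝ (Fin 3) → ℝ) (v : EuclideanSpace ℝ (Fin 3)) : ℝ :=
  Real.sqrt (gradNormSq φ v)

open Filter Topology
open scoped SchwartzMap LineDeriv Laplacian

/-- Euclidean three-space. -/
abbrev E3 := EuclideanSpace ℝ (Fin 3)

/-- Weight dominating all the kernels. -/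
def Wt (y : E3) : ℝ := (1 + ‖y‖⁻¹) ^ 2

/-- Integrable majorant. -/
def GG (y : E3) : ℝ := Wt y * ((1 + ‖y‖) ^ 4)⁻¹

lemma Wt_nonneg (y : E3) : 0 ≤ Wt y := sq_nonneg _

lemma GG_nonneg (y : E3) : 0 ≤ GG y := by
  unfold GG; have := Wt_nonneg y; positivity

lemma one_le_Wt (y : E3) : 1 ≤ Wt y := by
  unfold Wt
  have : 0 ≤ ‖y‖⁻¹ := by positivity
  nlinarith

lemma inv_le_Wt (y : E3) : ‖y‖⁻¹ ≤ Wt y := by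
  unfold Wt
  have : 0 ≤ ‖y‖⁻¹ := by positivity
  nlinarith

lemma inv_sq_le_Wt (y : E3) : (‖y‖ ^ 2)⁻¹ ≤ Wt y := by
  unfold Wt
  have : 0 ≤ ‖y‖⁻¹ := by positivity
  rw [← inv_pow]
  nlinarith

lemma int4_real : IntegrableOn (fun r : ℝ => ((1 + r) ^ 2)⁻¹) (Ioi 0) := by
  have h := integrableOn_add_rpow_Ioi_of_lt (a := (-2 : ℝ)) (c := 0) (m := 1) (by norm_num) (by norm_num)
  refine h.congr_fun (fun r hr => ?_) measurableSet_Ioi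
  have hr : (0 : ℝ) < r := hr
  simp only
  rw [Real.rpow_neg (by linarith), add_comm]
  norm_num

lemma ae_ne_zero : ∀ᵐ y : E3, y ≠ 0 := by
  simp [ae_iff, measure_singleton]

lemma GG_integrable : Integrable GG := by
  have h : Integrable (fun y : E3 => (fun r : ℝ => (r ^ 2)⁻¹ * ((1 + r) ^ 2)⁻¹) ‖y‖) := by
    refine (integrable_fun_norm_addHaar volume
      (f := fun r : ℝ => (r ^ 2)⁻¹ * ((1 + r) ^ 2)⁻¹)).2 ?_
    refine int4_real.congr_fun (fun r hr => ?_) measurableSet_Ioi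
    have hr : (0 : ℝ) < r := hr
    simp
    field_simp
  refine h.congr ?_
  filter_upwards [ae_ne_zero] with y hy
  have : 0 < ‖y‖ := norm_pos_iff.2 hy
  simp only [GG, Wt]
  field_simp
  ring

lemma int4 : Integrable (fun y : E3 => ((1 + ‖y‖) ^ 4)⁻¹) := by
  refine GG_integrable.mono' (by fun_prop) (ae_of_all _ fun y => ?_)
  rw [Real.norm_of_nonneg (by positivity)]
  unfold GG
  have := one_le_Wt y
  have h2 : 0 ≤ ((1 + ‖y‖) ^ 4)⁻¹ := by positivity
  nlinarith

variable {F : Type*} [NormedAddCommGroup F] [NormedSpace ℝ F]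

lemma schwartz_bound (h : 𝓢(E3, F)) (k : ℕ) :
    ∃ C, 0 ≤ C ∧ ∀ x, ‖h x‖ ≤ C * ((1 + ‖x‖) ^ k)⁻¹ := by
  refine ⟨2 ^ k * (Finset.Iic (k, 0)).sup (fun m => SchwartzMap.seminorm ℝ m.1 m.2) h, ?_, ?_⟩
  · positivity
  · intro x
    have := SchwartzMap.one_add_le_sup_seminorm_apply (𝕜 := ℝ) (m := (k, 0)) (k := k) (n := 0)
      le_rfl le_rfl h x
    rw [norm_iteratedFDeriv_zero] at this
    rw [← div_eq_mul_inv, le_div_iff₀ (by positivity), mul_comm]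
    exact this

lemma peetre (v y : E3) : 1 + ‖y‖ ≤ (1 + ‖v + y‖) * (1 + ‖v‖) := by
  have : ‖y‖ ≤ ‖v + y‖ + ‖v‖ := by
    have := norm_sub_le (v + y) v
    simpa using this
  nlinarith [norm_nonneg v, norm_nonneg (v + y)]

lemma peetre' (v y : E3) : 1 + ‖v‖ ≤ (1 + ‖v + y‖) * (1 + ‖y‖) := by
  have : ‖v‖ ≤ ‖v + y‖ + ‖y‖ := by
    have := norm_sub_le (v + y) y
    simpa using this
  nlinarith [norm_nonneg y, norm_nonneg (v + y)]

lemma peetre_inv (v y : E3) : ((1 + ‖v + y‖) ^ 4)⁻¹ ≤ (1 + ‖v‖) ^ 4 * ((1 + ‖y‖) ^ 4)⁻¹ := by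
  have h := peetre v y
  have h4 : (1 + ‖y‖) ^ 4 ≤ ((1 + ‖v + y‖) * (1 + ‖v‖)) ^ 4 := by gcongr
  rw [mul_pow] at h4
  rw [← div_eq_mul_inv, inv_eq_one_div, div_le_div_iff₀ (by positivity) (by positivity)]
  linarith

lemma dom_bound {k : E3 → ℝ} {A : ℝ} (hk : ∀ y ≠ 0, |k y| ≤ A * Wt y) {h : E3 → F} {C : ℝ}
    (hC : 0 ≤ C) (hh : ∀ x, ‖h x‖ ≤ C * ((1 + ‖x‖) ^ 4)⁻¹) (v y : E3) (hy : y ≠ 0) :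
    ‖k y • h (v + y)‖ ≤ A * C * (1 + ‖v‖) ^ 4 * GG y := by
  rw [norm_smul, Real.norm_eq_abs]
  have h1 := hk y hy
  have h2 : ‖h (v + y)‖ ≤ C * ((1 + ‖v‖) ^ 4 * ((1 + ‖y‖) ^ 4)⁻¹) :=
    (hh _).trans (by gcongr; exact peetre_inv v y)
  calc |k y| * ‖h (v + y)‖ ≤ (A * Wt y) * (C * ((1 + ‖v‖) ^ 4 * ((1 + ‖y‖) ^ 4)⁻¹)) := by
        apply mul_le_mul h1 h2 (norm_nonneg _) ((abs_nonneg _).trans h1)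
    _ = _ := by unfold GG; ring

/-- Convolution-type operator. -/
def TK (k : E3 → ℝ) (h : E3 → F) (v : E3) : F := ∫ y, k y • h (v + y)

lemma TK_integrable {k : E3 → ℝ} {A : ℝ} (hk : ∀ y ≠ 0, |k y| ≤ A * Wt y)
    (hm : AEStronglyMeasurable k volume) (h : 𝓢(E3, F)) (v : E3) :
    Integrable (fun y => k y • h (v + y)) := by
  obtain ⟨C, hC, hh⟩ := schwartz_bound h 4
  refine (GG_integrable.const_mul (A * C * (1 + ‖v‖) ^ 4)).mono' ?_
    (by filter_upwards [ae_ne_zero] with y hy using dom_bound hk hC hh v y hy)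
  exact hm.smul (by have := h.continuous; fun_prop)

lemma TK_hasFDerivAt {k : E3 → ℝ} {A : ℝ} (hk : ∀ y ≠ 0, |k y| ≤ A * Wt y)
    (hm : AEStronglyMeasurable k volume) (h : 𝓢(E3, F)) (v : E3) :
    HasFDerivAt (TK k h) (TK k (SchwartzMap.fderivCLM ℝ E3 F h) v) v := by
  obtain ⟨C, hC, hh⟩ := schwartz_bound (SchwartzMap.fderivCLM ℝ E3 F h) 4
  have hA : 0 ≤ A := by
    obtain ⟨y0, hy0⟩ := exists_ne (0 : E3)
    have := (abs_nonneg _).trans (hk y0 hy0)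
    have h1 := one_le_Wt y0
    by_contra hA
    push Not at hA
    nlinarith
  unfold TK
  refine hasFDerivAt_integral_of_dominated_of_fderiv_le (s := Metric.ball v 1)
    (bound := fun y => A * C * (2 + ‖v‖) ^ 4 * GG y) 
    (F' := fun v y => k y • (SchwartzMap.fderivCLM ℝ E3 F h) (v + y))
    (Metric.ball_mem_nhds v one_pos) ?_ ?_ ?_ ?_ ?_ ?_
  · exact Eventually.of_forall fun u => (TK_integrable hk hm h u).1
  · exact TK_integrable hk hm h v
  · exact (TK_integrable hk hm _ v).1
  · filter_upwards [ae_ne_zero] with y hy u hu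
    refine (dom_bound hk hC hh u y hy).trans ?_
    have : ‖u‖ ≤ 1 + ‖v‖ := by
      have h1 : ‖u - v‖ < 1 := by simpa [dist_eq_norm] using hu
      have := norm_sub_norm_le u v
      linarith
    have := GG_nonneg y
    have h2 : 1 + ‖u‖ ≤ 2 + ‖v‖ := by linarith
    have h3 : (1 + ‖u‖) ^ 4 ≤ (2 + ‖v‖) ^ 4 := by gcongr
    gcongr
  · exact GG_integrable.const_mul _
  · refine ae_of_all _ fun y u hu => ?_
    have h1 : HasFDerivAt (fun u => h (u + y)) (fderiv ℝ h (u + y)) u :=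
      (hasFDerivAt_comp_add_right y).2 (h.hasFDerivAt (u + y))
    exact h1.const_smul (k y)

/-- Coordinate derivative of a Schwartz function. -/
def DD (i : Fin 3) (h : 𝓢(E3, ℝ)) : 𝓢(E3, ℝ) := ∂_{(EuclideanSpace.single i (1 : ℝ) : E3)} h

lemma DD_apply (i : Fin 3) (h : 𝓢(E3, ℝ)) (x : E3) :
    DD i h x = fderiv ℝ h x (EuclideanSpace.single i 1) :=
  SchwartzMap.lineDerivOp_apply_eq_fderiv _ _ _

lemma TK_fderiv_apply {k : E3 → ℝ} {A : ℝ} (hk : ∀ y ≠ 0, |k y| ≤ A * Wt y)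
    (hm : AEStronglyMeasurable k volume) (h : 𝓢(E3, ℝ)) (v : E3) (i : Fin 3) :
    fderiv ℝ (TK k h) v (EuclideanSpace.single i 1) = TK k (DD i h) v := by
  rw [(TK_hasFDerivAt hk hm h v).fderiv]
  unfold TK
  rw [ContinuousLinearMap.integral_apply (TK_integrable hk hm _ v)]
  simp only [DD_apply]
  rfl

lemma TK_pd {k : E3 → ℝ} {A : ℝ} (hk : ∀ y ≠ 0, |k y| ≤ A * Wt y)
    (hm : AEStronglyMeasurable k volume) (h : 𝓢(E3, ℝ)) (v : E3) (i : Fin 3) :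
    pd i (TK k h) v = TK k (DD i h) v := TK_fderiv_apply hk hm h v i

lemma TK_contDiff {k : E3 → ℝ} {A : ℝ} (hk : ∀ y ≠ 0, |k y| ≤ A * Wt y)
    (hm : AEStronglyMeasurable k volume) (h : 𝓢(E3, ℝ)) : ContDiff ℝ 1 (TK k h) := by
  rw [contDiff_one_iff_fderiv]
  refine ⟨fun v => (TK_hasFDerivAt hk hm h v).differentiableAt, ?_⟩
  have : fderiv ℝ (TK k h) = TK k (SchwartzMap.fderivCLM ℝ E3 ℝ h) :=
    funext fun v => (TK_hasFDerivAt hk hm h v).fderiv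
  rw [this]
  exact continuous_iff_continuousAt.2 fun v =>
    (TK_hasFDerivAt hk hm (SchwartzMap.fderivCLM ℝ E3 ℝ h) v).continuousAt

lemma TK_tendsto {k : E3 → ℝ} {kd : ℝ → E3 → ℝ} {A : ℝ} 
    (hk : ∀ δ > 0, ∀ y ≠ 0, |kd δ y| ≤ A * Wt y)
    (hm : ∀ δ > 0, AEStronglyMeasurable (kd δ) volume) 
    (hlim : ∀ y ≠ 0, Tendsto (fun δ => kd δ y) (𝓝[>] 0) (𝓝 (k y))) (h : 𝓢(E3, ℝ)) (v : E3) :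
    Tendsto (fun δ => TK (kd δ) h v) (𝓝[>] 0) (𝓝 (TK k h v)) := by
  obtain ⟨C, hC, hh⟩ := schwartz_bound h 4
  unfold TK
  refine tendsto_integral_filter_of_dominated_convergence
    (fun y => A * C * (1 + ‖v‖) ^ 4 * GG y) ?_ ?_ (GG_integrable.const_mul _) ?_
  · filter_upwards [self_mem_nhdsWithin] with δ hδ
    exact (TK_integrable (hk δ hδ) (hm δ hδ) h v).1
  · filter_upwards [self_mem_nhdsWithin] with δ hδ
    filter_upwards [ae_ne_zero] with y hy using dom_bound (hk δ hδ) hC hh v y hy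
  · filter_upwards [ae_ne_zero] with y hy
    exact (hlim y hy).smul_const _

lemma TK_ibp {K K' : E3 → ℝ} {A A' : ℝ} (hk : ∀ y ≠ 0, |K y| ≤ A * Wt y)
    (hm : AEStronglyMeasurable K volume) (hk' : ∀ y ≠ 0, |K' y| ≤ A' * Wt y)
    (hm' : AEStronglyMeasurable K' volume) (i : Fin 3)
    (hd : ∀ x, HasLineDerivAt ℝ K (K' x) x (EuclideanSpace.single i 1))
    (h : 𝓢(E3, ℝ)) (v : E3) :
    TK K (DD i h) v = - TK K' h v := by
  have := integral_bilinear_hasLineDerivAt_right_eq_neg_left_of_integrable (μ := (volume : Measure E3))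
    (f := K) (f' := K') (g := fun y => h (v + y)) (g' := fun y => DD i h (v + y)) 
    (v := EuclideanSpace.single i 1)
    (B := ContinuousLinearMap.mul ℝ ℝ) (TK_integrable hk' hm' h v) (TK_integrable hk hm _ v)
    (TK_integrable hk hm h v) (fun x _ => hd x) (fun x _ => by
      rw [DD_apply]
      have h1 : HasFDerivAt (fun u => h (v + u)) (fderiv ℝ h (v + x)) x :=
        (hasFDerivAt_comp_add_left v).2 (h.hasFDerivAt (v + x))
      exact h1.hasLineDerivAt _)
  exact this

/-- Regularised norm. -/
def SS (δ : ℝ) (y : E3) : ℝ := Real.sqrt (δ ^ 2 + ‖y‖ ^ 2)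

lemma SS_sq (δ : ℝ) (y : E3) : SS δ y ^ 2 = δ ^ 2 + ‖y‖ ^ 2 :=
  Real.sq_sqrt (by positivity)

lemma SS_pos {δ : ℝ} (hδ : 0 < δ) (y : E3) : 0 < SS δ y := Real.sqrt_pos.2 (by positivity)

lemma SS_ge_norm (δ : ℝ) (y : E3) : ‖y‖ ≤ SS δ y := Real.le_sqrt_of_sq_le (by nlinarith [sq_nonneg δ])

lemma SS_ge {δ : ℝ} (y : E3) : δ ≤ SS δ y := Real.le_sqrt_of_sq_le (by nlinarith [sq_nonneg ‖y‖])

lemma SS_cont (δ : ℝ) : Continuous (SS δ) := by unfold SS; fun_prop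

lemma SS_tendsto (y : E3) : Tendsto (fun δ => SS δ y) (𝓝[>] 0) (𝓝 ‖y‖) := by
  have h : Continuous (fun δ => SS δ y) := by unfold SS; fun_prop
  have := h.tendsto 0
  have h0 : SS 0 y = ‖y‖ := by simp [SS]
  rw [h0] at this
  exact this.mono_left nhdsWithin_le_nhds

lemma abs_coord_le (y : E3) (i : Fin 3) : |y i| ≤ ‖y‖ := by
  have := EuclideanSpace.norm_sq_eq y
  simp only [Real.norm_eq_abs, sq_abs, Fin.sum_univ_three] at this
  refine abs_le_of_sq_le_sq ?_ (norm_nonneg _)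
  rw [this]
  fin_cases i <;> simp <;> linarith [sq_nonneg (y 0), sq_nonneg (y 1), sq_nonneg (y 2)]

lemma abs_coord_le_SS (δ : ℝ) (y : E3) (i : Fin 3) : |y i| ≤ SS δ y :=
  (abs_coord_le y i).trans (SS_ge_norm δ y)

lemma SS_inv_le (δ : ℝ) {y : E3} (hy : y ≠ 0) : (SS δ y)⁻¹ ≤ ‖y‖⁻¹ :=
  inv_anti₀ (norm_pos_iff.2 hy) (SS_ge_norm δ y)

lemma SS_inv_le_Wt (δ : ℝ) {y : E3} (hy : y ≠ 0) : (SS δ y)⁻¹ ≤ Wt y :=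
  (SS_inv_le δ hy).trans (inv_le_Wt y)

lemma SS_inv_sq_le_Wt (δ : ℝ) {y : E3} (hy : y ≠ 0) : (SS δ y)⁻¹ ^ 2 ≤ Wt y := by
  refine le_trans ?_ (inv_sq_le_Wt y)
  rw [← inv_pow]
  have := SS_inv_le δ hy
  have h0 : 0 ≤ (SS δ y)⁻¹ := inv_nonneg.2 (Real.sqrt_nonneg _)
  gcongr

lemma SS_line {δ : ℝ} (hδ : 0 < δ) (x : E3) (i : Fin 3) :
    HasDerivAt (fun t : ℝ => SS δ (x + t • EuclideanSpace.single i 1)) (x i * (SS δ x)⁻¹) 0 := by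
  have h1 : (fun t : ℝ => SS δ (x + t • EuclideanSpace.single i 1)) =
      fun t : ℝ => Real.sqrt (δ ^ 2 + (‖x‖ ^ 2 + 2 * t * x i + t ^ 2)) := by
    funext t
    unfold SS
    congr 2
    rw [norm_add_sq_real, norm_smul, inner_smul_right]
    simp [EuclideanSpace.inner_single_right]
    ring
  rw [h1]
  have h2 : HasDerivAt (fun t : ℝ => δ ^ 2 + (‖x‖ ^ 2 + 2 * t * x i + t ^ 2)) (2 * x i) 0 := by
    have : HasDerivAt (fun t : ℝ => δ ^ 2 + (‖x‖ ^ 2 + 2 * t * x i + t ^ 2))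
        (((2 * 1) * x i) + 2 * (0 : ℝ) ^ 1 * 1) 0 := by
      apply HasDerivAt.const_add
      apply HasDerivAt.add
      · apply HasDerivAt.const_add
        exact ((hasDerivAt_id (0 : ℝ)).const_mul 2).mul_const _
      · simpa using hasDerivAt_pow 2 (0 : ℝ)
    convert this using 1
    ring
  have h3 := h2.sqrt (by simp only [mul_zero, zero_mul, add_zero]; positivity)
  convert h3 using 1
  have := SS_pos hδ x
  unfold SS at this ⊢
  simp
  field_simp

lemma coord_line (x : E3) (i j : Fin 3) :
    HasDerivAt (fun t : ℝ => (x + t • EuclideanSpace.single i (1 : ℝ) : E3) j)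
      (if j = i then 1 else 0) 0 := by
  have : (fun t : ℝ => (x + t • EuclideanSpace.single i (1 : ℝ) : E3) j) =
      fun t => x j + t * (if j = i then 1 else 0) := by
    funext t
    simp
  rw [this]
  simpa using ((hasDerivAt_id (0 : ℝ)).mul_const (if j = i then (1 : ℝ) else 0)).const_add (x j)

/-- Chain rule for functions of the regularised norm. -/
lemma SS_comp_line {δ : ℝ} (hδ : 0 < δ) {φ : ℝ → ℝ} {φ' : ℝ} (x : E3) (i : Fin 3)
    (hφ : HasDerivAt φ φ' (SS δ x)) :
    HasLineDerivAt ℝ (fun y => φ (SS δ y)) (φ' * (x i * (SS δ x)⁻¹)) x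
      (EuclideanSpace.single i 1) := by
  have h := SS_line hδ x i
  have hx : SS δ (x + (0 : ℝ) • EuclideanSpace.single i 1) = SS δ x := by simp
  rw [← hx] at hφ
  exact HasDerivAt.comp (0 : ℝ) hφ h

lemma coord_hasLine (x : E3) (i j : Fin 3) :
    HasLineDerivAt ℝ (fun y : E3 => y j) (if j = i then 1 else 0) x
      (EuclideanSpace.single i (1 : ℝ)) := coord_line x i j

lemma HasLineDerivAt.mul' {f g : E3 → ℝ} {f' g' : ℝ} {x e : E3} (hf : HasLineDerivAt ℝ f f' x e)
    (hg : HasLineDerivAt ℝ g g' x e) :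
    HasLineDerivAt ℝ (fun y => f y * g y) (f' * g x + f x * g') x e := by
  have := HasDerivAt.mul hf hg
  simp only [zero_smul, add_zero] at this
  exact this

/-- The regularised Yukawa profile and its derivatives. -/
def k0 (c s : ℝ) : ℝ := Real.exp (-(c * s)) * s⁻¹
def k1 (c s : ℝ) : ℝ := Real.exp (-(c * s)) * (c * s⁻¹ ^ 2 + s⁻¹ ^ 3)
def k2 (c s : ℝ) : ℝ := Real.exp (-(c * s)) * (c ^ 2 * s⁻¹ ^ 3 + 3 * c * s⁻¹ ^ 4 + 3 * s⁻¹ ^ 5)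

lemma k0_deriv (c : ℝ) {s : ℝ} (hs : 0 < s) : HasDerivAt (k0 c) (-(s * k1 c s)) s := by
  unfold k0 k1
  have h1 : HasDerivAt (fun s => Real.exp (-(c * s))) (Real.exp (-(c * s)) * (-(c * 1))) s :=
    ((hasDerivAt_id s).const_mul c).neg.exp
  have := h1.mul (hasDerivAt_inv hs.ne')
  refine this.congr_deriv ?_
  field_simp
  ring

lemma k1_deriv (c : ℝ) {s : ℝ} (hs : 0 < s) : HasDerivAt (k1 c) (-(s * k2 c s)) s := by
  unfold k1 k2
  have h1 : HasDerivAt (fun s => Real.exp (-(c * s))) (Real.exp (-(c * s)) * (-(c * 1))) s :=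
    ((hasDerivAt_id s).const_mul c).neg.exp
  have hi := hasDerivAt_inv hs.ne'
  have := h1.mul (((hi.pow 2).const_mul c).add (hi.pow 3))
  refine this.congr_deriv ?_
  simp
  field_simp
  ring

lemma k0_line {δ : ℝ} (hδ : 0 < δ) (c : ℝ) (x : E3) (i : Fin 3) :
    HasLineDerivAt ℝ (fun y => k0 c (SS δ y)) (-(x i * k1 c (SS δ x))) x
      (EuclideanSpace.single i 1) := by
  have hs := SS_pos hδ x
  convert SS_comp_line hδ x i (k0_deriv c hs) using 1
  field_simp

lemma k1_line {δ : ℝ} (hδ : 0 < δ) (c : ℝ) (x : E3) (i : Fin 3) :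
    HasLineDerivAt ℝ (fun y => k1 c (SS δ y)) (-(x i * k2 c (SS δ x))) x
      (EuclideanSpace.single i 1) := by
  have hs := SS_pos hδ x
  convert SS_comp_line hδ x i (k1_deriv c hs) using 1
  field_simp

lemma k_cont {δ : ℝ} (hδ : 0 < δ) (c : ℝ) : Continuous (fun y => k0 c (SS δ y)) ∧
    Continuous (fun y => k1 c (SS δ y)) ∧ Continuous (fun y => k2 c (SS δ y)) := by
  have h := SS_cont δ
  have hi : Continuous (fun y => (SS δ y)⁻¹) := h.inv₀ fun y => (SS_pos hδ y).ne'
  unfold k0 k1 k2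
  refine ⟨by fun_prop, by fun_prop, by fun_prop⟩

lemma exp_le_one' {c s : ℝ} (hc : 0 ≤ c) (hs : 0 ≤ s) : Real.exp (-(c * s)) ≤ 1 :=
  Real.exp_le_one_iff.2 (by nlinarith [mul_nonneg hc hs])

lemma k0_bound {c : ℝ} (hc : 0 ≤ c) {s : ℝ} (hs : 0 < s) : |k0 c s| ≤ s⁻¹ := by
  unfold k0
  have h0 : 0 < s⁻¹ := inv_pos.2 hs
  rw [abs_of_nonneg (by positivity)]
  nlinarith [exp_le_one' hc hs.le]

lemma k1_bound {c : ℝ} (hc : 0 ≤ c) {s : ℝ} (hs : 0 < s) : |k1 c s| ≤ c * s⁻¹ ^ 2 + s⁻¹ ^ 3 := by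
  unfold k1
  have h0 : 0 < s⁻¹ := inv_pos.2 hs
  rw [abs_of_nonneg (by positivity)]
  exact mul_le_of_le_one_left (by positivity) (exp_le_one' hc hs.le)

lemma k2_bound {c : ℝ} (hc : 0 ≤ c) {s : ℝ} (hs : 0 < s) :
    |k2 c s| ≤ c ^ 2 * s⁻¹ ^ 3 + 3 * c * s⁻¹ ^ 4 + 3 * s⁻¹ ^ 5 := by
  unfold k2
  have h0 : 0 < s⁻¹ := inv_pos.2 hs
  rw [abs_of_nonneg (by positivity)]
  exact mul_le_of_le_one_left (by positivity) (exp_le_one' hc hs.le)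

lemma xk1_bound {c : ℝ} (hc : 0 ≤ c) {δ : ℝ} (hδ : 0 < δ) (i : Fin 3) {y : E3} (hy : y ≠ 0) :
    |-(y i * k1 c (SS δ y))| ≤ (c + 1) * Wt y := by
  have hs := SS_pos hδ y
  have h1 := SS_inv_le_Wt δ hy
  have h2 := SS_inv_sq_le_Wt δ hy
  have h3 := abs_coord_le_SS δ y i
  rw [abs_neg, abs_mul]
  calc |y i| * |k1 c (SS δ y)| ≤ SS δ y * (c * (SS δ y)⁻¹ ^ 2 + (SS δ y)⁻¹ ^ 3) :=
        mul_le_mul h3 (k1_bound hc hs) (abs_nonneg _) hs.le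
    _ = c * (SS δ y)⁻¹ + (SS δ y)⁻¹ ^ 2 := by field_simp
    _ ≤ c * Wt y + Wt y := by gcongr
    _ = _ := by ring

/-- the second derivative of the regularised kernel -/
def kk (c δ : ℝ) (i : Fin 3) (y : E3) : ℝ := k1 c (SS δ y) - y i ^ 2 * k2 c (SS δ y)

lemma kk_line {δ : ℝ} (hδ : 0 < δ) (c : ℝ) (x : E3) (i : Fin 3) :
    HasLineDerivAt ℝ (fun y => -(y i * k1 c (SS δ y))) (-(kk c δ i x)) x
      (EuclideanSpace.single i 1) := by
  have := HasDerivAt.neg (HasLineDerivAt.mul' (coord_hasLine x i i) (k1_line hδ c x i))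
  refine HasDerivAt.congr_deriv (f' := _) this ?_
  simp [kk]
  ring

lemma kk_bound {c : ℝ} (hc : 0 ≤ c) {δ : ℝ} (hδ : 0 < δ) (i : Fin 3) {y : E3} (hy : y ≠ 0) :
    |-(kk c δ i y)| ≤ ((c + δ⁻¹) + (c ^ 2 + 3 * c + 3 * δ⁻¹)) * Wt y := by
  have hs := SS_pos hδ y
  have h1 := SS_inv_le_Wt δ hy
  have h2 := SS_inv_sq_le_Wt δ hy
  have h3 := abs_coord_le_SS δ y i
  have h4 : (SS δ y)⁻¹ ≤ δ⁻¹ := inv_anti₀ hδ (SS_ge y)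
  have h5 : (SS δ y)⁻¹ ^ 3 ≤ δ⁻¹ * Wt y := by
    calc (SS δ y)⁻¹ ^ 3 = (SS δ y)⁻¹ * (SS δ y)⁻¹ ^ 2 := by ring
      _ ≤ _ := mul_le_mul h4 h2 (by positivity) (by positivity)
  have h6 : |y i ^ 2 * k2 c (SS δ y)| ≤ (c ^ 2 + 3 * c + 3 * δ⁻¹) * Wt y := by
    rw [abs_mul, abs_pow]
    calc |y i| ^ 2 * |k2 c (SS δ y)| ≤ SS δ y ^ 2 *
          (c ^ 2 * (SS δ y)⁻¹ ^ 3 + 3 * c * (SS δ y)⁻¹ ^ 4 + 3 * (SS δ y)⁻¹ ^ 5) :=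
          mul_le_mul (by gcongr) (k2_bound hc hs) (abs_nonneg _) (by positivity)
      _ = c ^ 2 * (SS δ y)⁻¹ + 3 * c * (SS δ y)⁻¹ ^ 2 + 3 * (SS δ y)⁻¹ ^ 3 := by field_simp
      _ ≤ c ^ 2 * Wt y + 3 * c * Wt y + 3 * (δ⁻¹ * Wt y) := by gcongr
      _ = _ := by ring
  have h7 : |k1 c (SS δ y)| ≤ (c + δ⁻¹) * Wt y := by
    calc _ ≤ _ := k1_bound hc hs
      _ ≤ c * Wt y + δ⁻¹ * Wt y := by gcongr
      _ = _ := by ring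
  rw [abs_neg]
  unfold kk
  refine (abs_sub _ _).trans ?_
  rw [add_mul]
  exact add_le_add h7 h6

lemma norm_sq_three (y : E3) : ‖y‖ ^ 2 = y 0 ^ 2 + y 1 ^ 2 + y 2 ^ 2 := by
  rw [EuclideanSpace.norm_sq_eq]
  simp [Fin.sum_univ_three]

lemma kk_sum {δ : ℝ} (hδ : 0 < δ) (c : ℝ) (y : E3) :
    ∑ i, kk c δ i y = -(c ^ 2 * k0 c (SS δ y)) + δ ^ 2 * k2 c (SS δ y) := by
  have hs := SS_pos hδ y
  have h1 := SS_sq δ y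
  rw [norm_sq_three] at h1
  rw [Fin.sum_univ_three]
  simp only [kk]
  have h2 : δ ^ 2 = SS δ y ^ 2 - (y 0 ^ 2 + y 1 ^ 2 + y 2 ^ 2) := by linarith
  rw [h2]
  unfold k0 k1 k2
  field_simp
  ring

lemma k0_boundW {c : ℝ} (hc : 0 ≤ c) {δ : ℝ} (hδ : 0 < δ) {y : E3} (hy : y ≠ 0) :
    |k0 c (SS δ y)| ≤ 1 * Wt y := by
  rw [one_mul]
  exact (k0_bound hc (SS_pos hδ y)).trans (SS_inv_le_Wt δ hy)

lemma xk1_cont {δ : ℝ} (hδ : 0 < δ) (c : ℝ) (i : Fin 3) :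
    Continuous (fun y : E3 => -(y i * k1 c (SS δ y))) := by
  have := (k_cont hδ c).2.1
  fun_prop

lemma kk_cont {δ : ℝ} (hδ : 0 < δ) (c : ℝ) (i : Fin 3) :
    Continuous (fun y : E3 => -(kk c δ i y)) := by
  have := (k_cont hδ c).2.1
  have := (k_cont hδ c).2.2
  unfold kk
  fun_prop

lemma ibp1 {c : ℝ} (hc : 0 ≤ c) {δ : ℝ} (hδ : 0 < δ) (i : Fin 3) (h : 𝓢(E3, ℝ)) (v : E3) :
    TK (fun y => k0 c (SS δ y)) (DD i h) v = - TK (fun y => -(y i * k1 c (SS δ y))) h v :=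
  TK_ibp (fun _ hy => k0_boundW hc hδ hy) (k_cont hδ c).1.aestronglyMeasurable
    (fun _ hy => xk1_bound hc hδ i hy) (xk1_cont hδ c i).aestronglyMeasurable i
    (fun x => k0_line hδ c x i) h v

lemma ibp2 {c : ℝ} (hc : 0 ≤ c) {δ : ℝ} (hδ : 0 < δ) (i : Fin 3) (h : 𝓢(E3, ℝ)) (v : E3) :
    TK (fun y => k0 c (SS δ y)) (DD i (DD i h)) v = TK (fun y => -(kk c δ i y)) h v := by
  rw [ibp1 hc hδ, TK_ibp (fun _ hy => xk1_bound hc hδ i hy) (xk1_cont hδ c i).aestronglyMeasurable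
    (fun _ hy => kk_bound hc hδ i hy) (kk_cont hδ c i).aestronglyMeasurable i
    (fun x => kk_line hδ c x i) h v, neg_neg]

/-- Laplacian -/
def LL (h : 𝓢(E3, ℝ)) : 𝓢(E3, ℝ) := ∑ i, DD i (DD i h)

lemma LL_apply (h : 𝓢(E3, ℝ)) (x : E3) : LL h x = ∑ i, DD i (DD i h) x := by
  simp [LL]

lemma fs_reg {c : ℝ} (hc : 0 ≤ c) {δ : ℝ} (hδ : 0 < δ) (h : 𝓢(E3, ℝ)) (v : E3) :
    TK (fun y => k0 c (SS δ y)) (c ^ 2 • h - LL h) v =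
      ∫ y, δ ^ 2 * k2 c (SS δ y) * h (v + y) := by
  have I0 : ∀ g : 𝓢(E3, ℝ), Integrable (fun y => k0 c (SS δ y) • g (v + y)) := fun g =>
    TK_integrable (fun _ hy => k0_boundW hc hδ hy) (k_cont hδ c).1.aestronglyMeasurable g v
  have I2 : ∀ i, Integrable (fun y => -(kk c δ i y) • h (v + y)) := fun i =>
    TK_integrable (fun _ hy => kk_bound hc hδ i hy) (kk_cont hδ c i).aestronglyMeasurable h v
  have e1 : TK (fun y => k0 c (SS δ y)) (c ^ 2 • h - LL h) v =
      c ^ 2 * TK (fun y => k0 c (SS δ y)) h v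
        - ∑ i, TK (fun y => k0 c (SS δ y)) (DD i (DD i h)) v := by
    unfold TK
    rw [← integral_const_mul, ← integral_finsetSum _ (fun i _ => I0 _), ← integral_sub]
    · congr 1
      funext y
      simp only [sub_apply, smul_apply, LL_apply, smul_eq_mul]
      rw [← Finset.mul_sum]
      ring
    · exact (I0 h).const_mul _
    · exact integrable_finsetSum _ (fun i _ => I0 _)
  rw [e1]
  simp_rw [ibp2 hc hδ]
  unfold TK
  rw [← integral_const_mul, ← integral_finsetSum _ (fun i _ => I2 i), ← integral_sub]
  · congr 1
    funext y
    simp only [smul_eq_mul]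
    rw [← Finset.sum_mul, Finset.sum_neg_distrib, kk_sum hδ]
    ring
  · exact (I0 h).const_mul _
  · exact integrable_finsetSum _ (fun i _ => I2 i)

lemma SS_scale {δ : ℝ} (hδ : 0 < δ) (y : E3) : SS δ (δ • y) = δ * SS 1 y := by
  unfold SS
  rw [norm_smul, Real.norm_of_nonneg hδ.le]
  have : δ ^ 2 + (δ * ‖y‖) ^ 2 = δ ^ 2 * (1 ^ 2 + ‖y‖ ^ 2) := by ring
  rw [this, Real.sqrt_mul (by positivity), Real.sqrt_sq hδ.le]

lemma fs_scale (c : ℝ) {δ : ℝ} (hδ : 0 < δ) (h : 𝓢(E3, ℝ)) (v : E3) :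
    ∫ y, δ ^ 2 * k2 c (SS δ y) * h (v + y) =
    ∫ y, δ ^ 5 * k2 c (δ * SS 1 y) * h (v + δ • y) := by
  have := Measure.integral_comp_smul (volume : Measure E3)
    (fun y => δ ^ 2 * k2 c (SS δ y) * h (v + y)) δ
  simp only [SS_scale hδ, finrank_euclideanSpace, Fintype.card_fin] at this
  have h2 : ∫ y : E3, δ ^ 5 * k2 c (δ * SS 1 y) * h (v + δ • y) =
      δ ^ 3 * ∫ y : E3, δ ^ 2 * k2 c (δ * SS 1 y) * h (v + δ • y) := by
    rw [← integral_const_mul]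
    congr 1
    funext y
    ring
  rw [h2, this, abs_of_nonneg (by positivity), smul_eq_mul]
  field_simp

lemma one_le_SS (y : E3) : 1 ≤ SS 1 y := SS_ge y

lemma k2_scaled (c : ℝ) {δ t : ℝ} (hδ : 0 < δ) (ht : 0 < t) :
    δ ^ 5 * k2 c (δ * t) = Real.exp (-(c * (δ * t))) *
      (c ^ 2 * δ ^ 2 * t⁻¹ ^ 3 + 3 * c * δ * t⁻¹ ^ 4 + 3 * t⁻¹ ^ 5) := by
  unfold k2
  field_simp

lemma k2_scaled_bound {c : ℝ} (hc : 0 ≤ c) {δ t : ℝ} (hδ : 0 < δ) (hδ1 : δ ≤ 1) (ht : 1 ≤ t) :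
    |δ ^ 5 * k2 c (δ * t)| ≤ (4 * c + 3) * t⁻¹ ^ 4 := by
  have ht0 : 0 < t := by linarith
  rw [k2_scaled c hδ ht0, abs_of_nonneg (by positivity)]
  have hti : t⁻¹ ≤ 1 := inv_le_one_of_one_le₀ ht
  have hti0 : 0 < t⁻¹ := inv_pos.2 ht0
  set E := Real.exp (-(c * (δ * t))) with hE
  have hE1 : E ≤ 1 := exp_le_one' hc (by positivity)
  have hE0 : 0 < E := Real.exp_pos _
  have hE2 : E * (c * δ * t) ≤ 1 := by
    have h1 := Real.add_one_le_exp (c * (δ * t))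
    have h2 : E * Real.exp (c * (δ * t)) = 1 := by
      rw [hE, ← Real.exp_add]; simp
    nlinarith
  have e : E * (c ^ 2 * δ ^ 2 * t⁻¹ ^ 3 + 3 * c * δ * t⁻¹ ^ 4 + 3 * t⁻¹ ^ 5) =
      (E * (c * δ * t)) * (c * δ) * t⁻¹ ^ 4 + E * (3 * c * δ) * t⁻¹ ^ 4 + E * (3 * t⁻¹) * t⁻¹ ^ 4 := by
    field_simp
  rw [e]
  have a1 : (E * (c * δ * t)) * (c * δ) ≤ 1 * (c * 1) := by gcongr
  have a2 : E * (3 * c * δ) ≤ 1 * (3 * c * 1) := by gcongr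
  have a3 : E * (3 * t⁻¹) ≤ 1 * (3 * 1) := by gcongr
  calc _ ≤ 1 * (c * 1) * t⁻¹ ^ 4 + 1 * (3 * c * 1) * t⁻¹ ^ 4 + 1 * (3 * 1) * t⁻¹ ^ 4 := by gcongr
    _ = _ := by ring

lemma SS4_int : Integrable (fun y : E3 => (SS 1 y)⁻¹ ^ 4) := by
  have hi : Continuous (fun y => (SS 1 y)⁻¹) := (SS_cont 1).inv₀ fun y => (SS_pos one_pos y).ne'
  refine (int4.const_mul 16).mono' (hi.pow 4).aestronglyMeasurable (ae_of_all _ fun y => ?_)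
  have h1 := one_le_SS y
  have h2 := SS_ge_norm 1 y
  rw [Real.norm_of_nonneg (by positivity), inv_pow, ← div_eq_mul_inv, inv_eq_one_div,
    div_le_div_iff₀ (by positivity) (by positivity)]
  have : (1 + ‖y‖) ^ 4 ≤ (2 * SS 1 y) ^ 4 := by gcongr; linarith
  rw [mul_pow] at this
  norm_num at this ⊢
  exact this

lemma SS5_integral : ∫ y : E3, 3 * (SS 1 y)⁻¹ ^ 5 = 4 * Real.pi := by
  have h1 := integral_fun_norm_addHaar (volume : Measure E3)
    (fun r : ℝ => 3 * (Real.sqrt (1 ^ 2 + r ^ 2))⁻¹ ^ 5)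
  have hd : ∀ r : ℝ, HasDerivAt (fun r : ℝ => r ^ 3 * (Real.sqrt (1 ^ 2 + r ^ 2))⁻¹ ^ 3)
      (r ^ 2 * (3 * (Real.sqrt (1 ^ 2 + r ^ 2))⁻¹ ^ 5)) r := by
    intro r
    have hs : 0 < Real.sqrt (1 ^ 2 + r ^ 2) := Real.sqrt_pos.2 (by positivity)
    have hq : Real.sqrt (1 ^ 2 + r ^ 2) ^ 2 = 1 ^ 2 + r ^ 2 := Real.sq_sqrt (by positivity)
    have a1 : HasDerivAt (fun r : ℝ => 1 ^ 2 + r ^ 2) (2 * r) r := by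
      simpa using (hasDerivAt_pow 2 r).const_add (1 ^ 2)
    have a2 := ((a1.sqrt (by positivity)).inv hs.ne').pow 3
    have a3 := (hasDerivAt_pow 3 r).mul a2
    refine a3.congr_deriv ?_
    simp only [Pi.inv_apply, Pi.pow_apply, Nat.cast_ofNat, Nat.add_one_sub_one, show 3 - 1 = 2 from rfl]
    set s := Real.sqrt (1 ^ 2 + r ^ 2)
    have hr : r ^ 2 = s ^ 2 - 1 := by linarith
    field_simp
    first | linear_combination (-1) * hr | linear_combination (-r ^ 2) * hr
  have hlim : Tendsto (fun r : ℝ => r ^ 3 * (Real.sqrt (1 ^ 2 + r ^ 2))⁻¹ ^ 3) atTop (𝓝 1) := by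
    have b1 : Tendsto (fun r : ℝ => (Real.sqrt ((r⁻¹) ^ 2 + 1))⁻¹ ^ 3) atTop (𝓝 1) := by
      have b2 : Tendsto (fun r : ℝ => r⁻¹) atTop (𝓝 0) := tendsto_inv_atTop_zero
      have b3 : ContinuousAt (fun x : ℝ => (Real.sqrt (x ^ 2 + 1))⁻¹ ^ 3) 0 := by
        apply ContinuousAt.pow
        apply ContinuousAt.inv₀ (by fun_prop) (by simp)
      have := b3.tendsto.comp b2
      simpa [Function.comp_def] using this
    refine b1.congr' ?_
    filter_upwards [eventually_gt_atTop 0] with r hr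
    have : (1 : ℝ) ^ 2 + r ^ 2 = r ^ 2 * ((r⁻¹) ^ 2 + 1) := by field_simp
    rw [this, Real.sqrt_mul (by positivity), Real.sqrt_sq hr.le, mul_inv, mul_pow, ← mul_assoc]
    field_simp
  have hI := integral_Ioi_of_hasDerivAt_of_nonneg' (a := 0) (fun r _ => hd r)
    (fun r _ => by positivity) hlim
  have hv : (volume : Measure E3).real (Metric.ball 0 1) = Real.pi * 4 / 3 := by
    rw [Measure.real, EuclideanSpace.volume_ball_fin_three]
    simp
    positivity
  simp only [finrank_euclideanSpace, Fintype.card_fin, Nat.add_one_sub_one, smul_eq_mul] at h1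
  have e : (fun y : E3 => 3 * (SS 1 y)⁻¹ ^ 5) =
    fun y : E3 => 3 * (Real.sqrt (1 ^ 2 + ‖y‖ ^ 2))⁻¹ ^ 5 := rfl
  rw [e, h1, hv]
  norm_num at hI ⊢
  rw [hI]
  ring

lemma fs_lim {c : ℝ} (hc : 0 ≤ c) (h : 𝓢(E3, ℝ)) (v : E3) :
    Tendsto (fun δ => ∫ y, δ ^ 5 * k2 c (δ * SS 1 y) * h (v + δ • y)) (𝓝[>] 0)
      (𝓝 (4 * Real.pi * h v)) := by
  obtain ⟨C, hC, hh⟩ := schwartz_bound h 0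
  simp only [pow_zero, inv_one, mul_one] at hh
  rw [← SS5_integral, ← integral_mul_const]
  have hi : Continuous (fun y => (SS 1 y)⁻¹) := (SS_cont 1).inv₀ fun y => (SS_pos one_pos y).ne'
  have hS := SS_cont 1
  have hhc := h.continuous
  refine tendsto_integral_filter_of_dominated_convergence
    (fun y => (4 * c + 3) * (SS 1 y)⁻¹ ^ 4 * C) ?_ ?_ ((SS4_int.const_mul _).mul_const _) ?_
  · filter_upwards [self_mem_nhdsWithin] with δ hδ
    have hδ : 0 < δ := hδ
    simp only [k2_scaled c hδ (SS_pos one_pos _)]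
    apply Continuous.aestronglyMeasurable
    fun_prop
  · filter_upwards [self_mem_nhdsWithin, nhdsWithin_le_nhds (Iic_mem_nhds one_pos)] with δ hδ hδ1
    refine ae_of_all _ fun y => ?_
    rw [norm_mul, Real.norm_eq_abs]
    exact mul_le_mul (k2_scaled_bound hc hδ hδ1 (one_le_SS y)) (hh _) (norm_nonneg _) (by positivity)
  · refine ae_of_all _ fun y => ?_
    have hl : Tendsto (fun δ : ℝ => Real.exp (-(c * (δ * SS 1 y))) *
      (c ^ 2 * δ ^ 2 * (SS 1 y)⁻¹ ^ 3 + 3 * c * δ * (SS 1 y)⁻¹ ^ 4 + 3 * (SS 1 y)⁻¹ ^ 5)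
        * h (v + δ • y)) (𝓝[>] 0) (𝓝 (3 * (SS 1 y)⁻¹ ^ 5 * h v)) := by
      have : Continuous (fun δ : ℝ => Real.exp (-(c * (δ * SS 1 y))) *
        (c ^ 2 * δ ^ 2 * (SS 1 y)⁻¹ ^ 3 + 3 * c * δ * (SS 1 y)⁻¹ ^ 4 + 3 * (SS 1 y)⁻¹ ^ 5)
        * h (v + δ • y)) := by fun_prop
      have := this.tendsto 0
      simp only [zero_mul, mul_zero, neg_zero, Real.exp_zero, zero_smul, add_zero, one_mul,
        ne_eq, OfNat.ofNat_ne_zero, not_false_eq_true, zero_pow, zero_add] at this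
      exact this.mono_left nhdsWithin_le_nhds
    refine hl.congr' ?_
    filter_upwards [self_mem_nhdsWithin] with δ hδ
    rw [k2_scaled c hδ (SS_pos one_pos _)]

lemma k0_tendsto (c : ℝ) {y : E3} (hy : y ≠ 0) :
    Tendsto (fun δ => k0 c (SS δ y)) (𝓝[>] 0) (𝓝 (k0 c ‖y‖)) := by
  have h0 : 0 < ‖y‖ := norm_pos_iff.2 hy
  have : ContinuousAt (k0 c) ‖y‖ := (k0_deriv c h0).continuousAt
  exact this.tendsto.comp (SS_tendsto y)

/-- `e^{-c|y|}/(4π|y|)` is the fundamental solution of `c² - Δ`. -/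
lemma fund_sol {c : ℝ} (hc : 0 ≤ c) (h : 𝓢(E3, ℝ)) (v : E3) :
    TK (fun y => k0 c ‖y‖) (c ^ 2 • h - LL h) v = 4 * Real.pi * h v := by
  have t1 := TK_tendsto (k := fun y => k0 c ‖y‖) (kd := fun δ y => k0 c (SS δ y)) (A := 1)
    (fun δ hδ y hy => k0_boundW hc hδ hy) (fun δ hδ => (k_cont hδ c).1.aestronglyMeasurable)
    (fun y hy => k0_tendsto c hy) (c ^ 2 • h - LL h) v
  refine tendsto_nhds_unique t1 ((fs_lim hc h v).congr' ?_)
  filter_upwards [self_mem_nhdsWithin] with δ hδ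
  rw [fs_reg hc hδ, fs_scale c hδ]

/-- Symbol of the Bessel potential. -/
def bsym (ξ : E3) : ℝ := (1 + ‖(2 * Real.pi) • ξ‖ ^ 2) ^ (-1 : ℝ)

lemma bsym_tg : bsym.HasTemperateGrowth := by
  have h1 := Function.hasTemperateGrowth_one_add_norm_sq_rpow E3 (-1)
  have h2 : (fun ξ : E3 => (2 * Real.pi) • ξ).HasTemperateGrowth := by fun_prop
  exact h1.comp h2

lemma bsym_eq (ξ : E3) : bsym ξ + (2 * Real.pi) ^ 2 * (‖ξ‖ ^ 2 * bsym ξ) = 1 := by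
  unfold bsym
  rw [Real.rpow_neg_one, norm_smul, mul_pow, Real.norm_eq_abs, sq_abs]
  have : 0 < 1 + (2 * Real.pi) ^ 2 * ‖ξ‖ ^ 2 := by positivity
  field_simp

lemma exists_complex (f : 𝓢(E3, ℂ)) : ∃ G : 𝓢(E3, ℂ), G - Δ G = f := by
  refine ⟨SchwartzMap.fourierMultiplierCLM ℂ bsym f, ?_⟩
  have hn : (fun x : E3 => ‖x‖ ^ 2).HasTemperateGrowth := by fun_prop
  rw [SchwartzMap.laplacian_eq_fourierMultiplierCLM,
    SchwartzMap.fourierMultiplierCLM_fourierMultiplierCLM_apply hn bsym_tg,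
    SchwartzMap.fourierMultiplierCLM_apply, SchwartzMap.fourierMultiplierCLM_apply, neg_smul,
    sub_neg_eq_add, ← FourierTransform.fourierInv_smul, ← FourierTransform.fourierInv_add]
  have hF : FourierTransform.fourierInv (FourierTransform.fourier f : 𝓢(E3, ℂ)) = f :=
    FourierTransform.fourierInv_fourier_eq f
  refine Eq.trans ?_ hF
  congr 1
  ext ξ
  have hm : ((fun x : E3 => ‖x‖ ^ 2) * bsym).HasTemperateGrowth := hn.mul bsym_tg
  rw [add_apply, smul_apply, SchwartzMap.smulLeftCLM_apply_apply bsym_tg,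
    SchwartzMap.smulLeftCLM_apply_apply hm, smul_smul, ← add_smul]
  simp only [Pi.mul_apply]
  rw [bsym_eq, one_smul]

lemma exists_bessel (w : 𝓢(E3, ℝ)) : ∃ g : 𝓢(E3, ℝ), g - LL g = w := by
  obtain ⟨G, hG⟩ := exists_complex (SchwartzMap.postcompCLM (𝕜 := ℝ) Complex.ofRealCLM w)
  refine ⟨SchwartzMap.postcompCLM (𝕜 := ℝ) Complex.reCLM G, ?_⟩
  have hD : ∀ (H : 𝓢(E3, ℂ)) (i : Fin 3), DD i (SchwartzMap.postcompCLM (𝕜 := ℝ) Complex.reCLM H) =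
      SchwartzMap.postcompCLM (𝕜 := ℝ) Complex.reCLM
        (∂_{(EuclideanSpace.single i (1 : ℝ) : E3)} H) := by
    intro H i
    ext x
    rw [DD_apply, SchwartzMap.postcompCLM_apply, SchwartzMap.lineDerivOp_apply_eq_fderiv]
    have : (⇑(SchwartzMap.postcompCLM (𝕜 := ℝ) Complex.reCLM H)) = Complex.reCLM ∘ H := rfl
    rw [this, (Complex.reCLM.hasFDerivAt.comp x H.differentiableAt.hasFDerivAt).fderiv]
    rfl
  have hL : LL (SchwartzMap.postcompCLM (𝕜 := ℝ) Complex.reCLM G) =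
      SchwartzMap.postcompCLM (𝕜 := ℝ) Complex.reCLM (Δ G) := by
    rw [SchwartzMap.laplacian_eq_sum (EuclideanSpace.basisFun (Fin 3) ℝ), map_sum]
    unfold LL
    simp only [hD, EuclideanSpace.basisFun_apply]
  rw [hL, ← map_sub, hG]
  ext x
  simp

/-- The Newton kernel. -/
def NK (c : ℝ) (y : E3) : ℝ := k0 c ‖y‖

lemma NK_bound {c : ℝ} (hc : 0 ≤ c) : ∀ y ≠ 0, |NK c y| ≤ 1 * Wt y := by
  intro y hy
  rw [one_mul]
  exact (k0_bound hc (norm_pos_iff.2 hy)).trans (inv_le_Wt y)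

lemma NK_meas (c : ℝ) : AEStronglyMeasurable (NK c) volume := by
  unfold NK k0
  exact Measurable.aestronglyMeasurable (by fun_prop)

lemma landaua_eq (h : 𝓢(E3, ℝ)) : landaua h = fun v => (1 / (4 * Real.pi)) * TK (NK 0) h v := by
  funext v
  unfold landaua TK
  rw [← integral_add_left_eq_self (fun z => h z / ‖v - z‖) v]
  congr 2
  funext y
  simp [NK, k0, div_eq_inv_mul]

lemma bessel_eq (h : 𝓢(E3, ℝ)) (v : E3) :
    besselM h v = (1 / (4 * Real.pi)) * TK (NK 1) h v := by
  unfold besselM TK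
  rw [← integral_add_left_eq_self (fun z => Real.exp (-‖v - z‖) / ‖v - z‖ * h z) v]
  congr 2
  funext y
  simp [NK, k0, div_eq_mul_inv]

lemma bessel_eq_g {w g : 𝓢(E3, ℝ)} (hg : g - LL g = w) : besselM w = g := by
  funext v
  have := fund_sol zero_le_one g v
  rw [one_pow, one_smul, hg] at this
  rw [bessel_eq]
  change TK (NK 1) w v = _ at this
  rw [this]
  field_simp

lemma TK_sub {k : E3 → ℝ} {A : ℝ} (hk : ∀ y ≠ 0, |k y| ≤ A * Wt y)
    (hm : AEStronglyMeasurable k volume) (h1 h2 : 𝓢(E3, ℝ)) (v : E3) :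
    TK k (h1 - h2) v = TK k h1 v - TK k h2 v := by
  unfold TK
  rw [← integral_sub (TK_integrable hk hm h1 v) (TK_integrable hk hm h2 v)]
  congr 1
  funext y
  rw [sub_apply, smul_sub]

lemma NK_LL (g : 𝓢(E3, ℝ)) (v : E3) : TK (NK 0) (LL g) v = -(4 * Real.pi * g v) := by
  have h := fund_sol le_rfl g v
  have e : (0 : ℝ) ^ 2 • g - LL g = 0 - LL g := by simp
  rw [e] at h
  change TK (NK 0) _ v = _ at h
  rw [TK_sub (NK_bound le_rfl) (NK_meas 0)] at h
  have h0 : TK (NK 0) (0 : 𝓢(E3, ℝ)) v = 0 := by simp [TK]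
  rw [h0] at h
  linarith

lemma landaua_decomp {w g : 𝓢(E3, ℝ)} (hg : g - LL g = w) :
    landaua w = fun v => landaua g v + g v := by
  funext v
  rw [landaua_eq, landaua_eq]
  simp only
  rw [← hg, TK_sub (NK_bound le_rfl) (NK_meas 0), NK_LL]
  field_simp
  ring

lemma landaua_pd (h : 𝓢(E3, ℝ)) (i : Fin 3) (v : E3) :
    pd i (landaua h) v = (1 / (4 * Real.pi)) * TK (NK 0) (DD i h) v := by
  rw [landaua_eq, ← TK_pd (NK_bound le_rfl) (NK_meas 0) h v i]
  unfold pd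
  rw [fderiv_const_mul (TK_hasFDerivAt (NK_bound le_rfl) (NK_meas 0) h v).differentiableAt]
  rfl

lemma landaua_diff (h : 𝓢(E3, ℝ)) (v : E3) : DifferentiableAt ℝ (landaua h) v := by
  rw [landaua_eq]
  exact (TK_hasFDerivAt (NK_bound le_rfl) (NK_meas 0) h v).differentiableAt.const_mul _

lemma second_identity {w g : 𝓢(E3, ℝ)} (hg : g - LL g = w) (i : Fin 3) (v : E3) :
    pd i (landaua w) v = pd i (landaua g) v + pd i g v := by
  rw [landaua_decomp hg]
  unfold pd
  rw [fderiv_fun_add (landaua_diff g v) g.differentiableAt]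
  rfl

/-- The regularised kernel `δ_{ij}/|y| + y_i y_j/|y|³`. -/
def ML (δ : ℝ) (i j : Fin 3) (y : E3) : ℝ :=
  (if i = j then 1 else 0) * k0 0 (SS δ y) + y i * y j * k1 0 (SS δ y)

/-- The kernel `δ_{ij}/|y| + y_i y_j/|y|³`. -/
def ML0 (i j : Fin 3) (y : E3) : ℝ :=
  (if i = j then 1 else 0) * k0 0 ‖y‖ + y i * y j * k1 0 ‖y‖

lemma ML_cont {δ : ℝ} (hδ : 0 < δ) (i j : Fin 3) : Continuous (ML δ i j) := by
  have h1 := (k_cont hδ 0).1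
  have h2 := (k_cont hδ 0).2.1
  unfold ML
  fun_prop

lemma ML_aux {s : ℝ} (hs : 0 < s) {W a b c : ℝ} (hW : s⁻¹ ≤ W) (ha : |a| ≤ s) (hb : |b| ≤ s)
    (hc : |c| ≤ 1) : |c * k0 0 s + a * b * k1 0 s| ≤ 2 * W := by
  refine (abs_add_le _ _).trans ?_
  rw [abs_mul, abs_mul, abs_mul]
  have e1 : |k0 0 s| ≤ s⁻¹ := k0_bound le_rfl hs
  have e2 : |k1 0 s| ≤ s⁻¹ ^ 3 := by simpa using k1_bound le_rfl hs
  calc |c| * |k0 0 s| + |a| * |b| * |k1 0 s| ≤ 1 * s⁻¹ + s * s * s⁻¹ ^ 3 := by gcongr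
    _ = 2 * s⁻¹ := by field_simp; ring
    _ ≤ _ := by gcongr

lemma ite_abs (i j : Fin 3) : |(if i = j then 1 else 0 : ℝ)| ≤ 1 := by
  split_ifs <;> simp

lemma ML_bound {δ : ℝ} (hδ : 0 < δ) (i j : Fin 3) : ∀ y ≠ 0, |ML δ i j y| ≤ 2 * Wt y :=
  fun y hy => ML_aux (SS_pos hδ y) (SS_inv_le_Wt δ hy) (abs_coord_le_SS δ y i)
    (abs_coord_le_SS δ y j) (ite_abs i j)

lemma ML0_bound (i j : Fin 3) : ∀ y ≠ 0, |ML0 i j y| ≤ 2 * Wt y :=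
  fun y hy => ML_aux (norm_pos_iff.2 hy) (inv_le_Wt y) (abs_coord_le y i)
    (abs_coord_le y j) (ite_abs i j)

lemma ML0_meas (i j : Fin 3) : AEStronglyMeasurable (ML0 i j) volume := by
  unfold ML0 k0 k1
  exact Measurable.aestronglyMeasurable (by fun_prop)

lemma ML_tendsto (i j : Fin 3) {y : E3} (hy : y ≠ 0) :
    Tendsto (fun δ => ML δ i j y) (𝓝[>] 0) (𝓝 (ML0 i j y)) := by
  have h1 : Tendsto (fun δ => k1 0 (SS δ y)) (𝓝[>] 0) (𝓝 (k1 0 ‖y‖)) :=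
    (k1_deriv 0 (norm_pos_iff.2 hy)).continuousAt.tendsto.comp (SS_tendsto y)
  exact ((k0_tendsto 0 hy).const_mul _).add (h1.const_mul _)

lemma ML_line {δ : ℝ} (hδ : 0 < δ) (i j : Fin 3) (x : E3) :
    HasLineDerivAt ℝ (ML δ i j) (x i * kk 0 δ j x) x (EuclideanSpace.single j 1) := by
  have h1 := HasDerivAt.const_mul (if i = j then (1 : ℝ) else 0) (k0_line hδ 0 x j)
  have h2 := HasLineDerivAt.mul' (HasLineDerivAt.mul' (coord_hasLine x j i) (coord_hasLine x j j))
    (k1_line hδ 0 x j)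
  refine HasDerivAt.congr_deriv (f' := _) (HasDerivAt.add h1 h2) ?_
  simp only [kk]
  split_ifs with hij
  · subst hij; simp; ring
  · simp; ring

lemma ykk_bound {δ : ℝ} (hδ : 0 < δ) (i j : Fin 3) : ∀ y ≠ 0, |y i * kk 0 δ j y| ≤ 4 * Wt y := by
  intro y hy
  have hs := SS_pos hδ y
  have h3 := abs_coord_le_SS δ y i
  have h4 := abs_coord_le_SS δ y j
  have e2 : |k1 0 (SS δ y)| ≤ (SS δ y)⁻¹ ^ 3 := by simpa using k1_bound le_rfl hs
  have e3 : |k2 0 (SS δ y)| ≤ 3 * (SS δ y)⁻¹ ^ 5 := by simpa using k2_bound le_rfl hs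
  have e4 : |kk 0 δ j y| ≤ 4 * (SS δ y)⁻¹ ^ 3 := by
    unfold kk
    refine (abs_sub _ _).trans ?_
    rw [abs_mul, abs_pow]
    calc _ ≤ (SS δ y)⁻¹ ^ 3 + SS δ y ^ 2 * (3 * (SS δ y)⁻¹ ^ 5) := by gcongr
      _ = _ := by field_simp; ring
  rw [abs_mul]
  calc _ ≤ SS δ y * (4 * (SS δ y)⁻¹ ^ 3) := by gcongr
    _ = 4 * (SS δ y)⁻¹ ^ 2 := by field_simp
    _ ≤ _ := by gcongr; exact SS_inv_sq_le_Wt δ hy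

lemma ykk_cont {δ : ℝ} (hδ : 0 < δ) (i j : Fin 3) :
    Continuous (fun y : E3 => y i * kk 0 δ j y) := by
  have := (k_cont hδ 0).2.1
  have := (k_cont hδ 0).2.2
  unfold kk
  fun_prop

lemma ML0_div (i : Fin 3) (h : 𝓢(E3, ℝ)) (v : E3) : ∑ j, TK (ML0 i j) (DD j h) v = 0 := by
  have t1 : Tendsto (fun δ => ∑ j, TK (ML δ i j) (DD j h) v) (𝓝[>] 0)
      (𝓝 (∑ j, TK (ML0 i j) (DD j h) v)) :=
    tendsto_finsetSum _ fun j _ => TK_tendsto (fun δ hδ => ML_bound hδ i j)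
      (fun δ hδ => (ML_cont hδ i j).aestronglyMeasurable) (fun y hy => ML_tendsto i j hy) (DD j h) v
  have t2 : Tendsto (fun δ => TK (fun y => ∑ j, y i * kk 0 δ j y) h v) (𝓝[>] 0)
      (𝓝 (TK (fun _ => 0) h v)) := by
    refine TK_tendsto (A := 12) (fun δ hδ y hy => ?_) (fun δ hδ => ?_) (fun y hy => ?_) h v
    · refine (Finset.abs_sum_le_sum_abs _ _).trans ?_
      refine (Finset.sum_le_sum fun j _ => ykk_bound hδ i j y hy).trans ?_
      simp
      linarith
    · exact (continuous_finsetSum _ fun j _ => ykk_cont hδ i j).aestronglyMeasurable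
    · have hc : ContinuousAt (k2 0) ‖y‖ := by
        have := norm_pos_iff.2 hy
        unfold k2
        have : ContinuousAt (fun s : ℝ => s⁻¹) ‖y‖ := continuousAt_inv₀ this.ne'
        fun_prop
      have hl : Tendsto (fun δ => y i * (δ ^ 2 * k2 0 (SS δ y))) (𝓝[>] 0)
          (𝓝 (y i * (0 ^ 2 * k2 0 ‖y‖))) := by
        refine Tendsto.const_mul _ (Tendsto.mul ?_ (hc.tendsto.comp (SS_tendsto y)))
        exact ((continuous_pow 2).tendsto (0 : ℝ)).mono_left nhdsWithin_le_nhds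
      have e0 : y i * (0 ^ 2 * k2 0 ‖y‖) = 0 := by simp
      rw [e0] at hl
      refine hl.congr' ?_
      filter_upwards [self_mem_nhdsWithin] with δ hδ
      rw [← Finset.mul_sum, kk_sum hδ]
      ring
  have e : TK (fun _ => 0) h v = 0 := by simp [TK]
  rw [e] at t2
  have t3 := t2.neg
  rw [neg_zero] at t3
  refine tendsto_nhds_unique t1 (t3.congr' ?_)
  filter_upwards [self_mem_nhdsWithin] with δ hδ
  have hδ : 0 < δ := hδ
  have : ∀ j, TK (ML δ i j) (DD j h) v = - TK (fun y => y i * kk 0 δ j y) h v := fun j =>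
    TK_ibp (ML_bound hδ i j) (ML_cont hδ i j).aestronglyMeasurable (ykk_bound hδ i j)
      (ykk_cont hδ i j).aestronglyMeasurable j (ML_line hδ i j) h v
  simp only [this, Finset.sum_neg_distrib]
  congr 1
  unfold TK
  rw [← integral_finsetSum]
  · simp only [Finset.sum_smul]
  · intro j _
    exact TK_integrable (ykk_bound hδ i j) (ykk_cont hδ i j).aestronglyMeasurable h v

lemma Pker_eq (i j : Fin 3) (y : E3) :
    Pker y i j / ‖y‖ = 2 * (if i = j then 1 else 0) * NK 0 y - ML0 i j y := by
  simp only [Pker, NK, ML0, k0, k1, div_eq_mul_inv, zero_mul, neg_zero, Real.exp_zero]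
  ring

lemma LandauA_eq (h : 𝓢(E3, ℝ)) (i j : Fin 3) : (fun u => LandauA h u i j) = fun v =>
    (1 / (8 * Real.pi)) * (2 * (if i = j then 1 else 0) * TK (NK 0) h v - TK (ML0 i j) h v) := by
  funext v
  unfold LandauA TK
  rw [← integral_add_left_eq_self (fun z => Pker (v - z) i j / ‖v - z‖ * h z) v,
    ← integral_const_mul (2 * (if i = j then (1 : ℝ) else 0)), ← integral_sub]
  · congr 2
    funext y
    have e1 : Pker (v - (v + y)) i j = Pker y i j := by simp [Pker]
    have e2 : ‖v - (v + y)‖ = ‖y‖ := by simp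
    rw [e1, e2, Pker_eq]
    simp only [smul_eq_mul]
    ring
  · exact (TK_integrable (NK_bound le_rfl) (NK_meas 0) h v).const_mul _
  · exact TK_integrable (ML0_bound i j) (ML0_meas i j) h v

lemma first_identity (h : 𝓢(E3, ℝ)) (i : Fin 3) (v : E3) :
    (∑ j, pd j (fun u => LandauA h u i j) v) = pd i (landaua h) v := by
  have key : ∀ j, pd j (fun u => LandauA h u i j) v = (1 / (8 * Real.pi)) *
      (2 * (if i = j then 1 else 0) * TK (NK 0) (DD j h) v - TK (ML0 i j) (DD j h) v) := by
    intro j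
    rw [LandauA_eq, ← TK_pd (NK_bound le_rfl) (NK_meas 0), ← TK_pd (ML0_bound i j) (ML0_meas i j)]
    have d1 := (TK_hasFDerivAt (NK_bound le_rfl) (NK_meas 0) h v).differentiableAt
    have d2 := (TK_hasFDerivAt (ML0_bound i j) (ML0_meas i j) h v).differentiableAt
    unfold pd
    rw [fderiv_const_mul ((d1.const_mul _).fun_sub d2), fderiv_fun_sub (d1.const_mul _) d2,
      fderiv_const_mul d1]
    rfl
  simp only [key]
  rw [← Finset.mul_sum, Finset.sum_sub_distrib, ML0_div, landaua_pd]
  simp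
  ring

lemma DD_comm (i j : Fin 3) (g : 𝓢(E3, ℝ)) : DD i (DD j g) = DD j (DD i g) := by
  have key : ∀ (i j : Fin 3) (x : E3), DD i (DD j g) x =
      fderiv ℝ (fderiv ℝ g) x (EuclideanSpace.single i 1) (EuclideanSpace.single j 1) := by
    intro i j x
    rw [DD_apply]
    have e : (⇑(DD j g)) = fun x => fderiv ℝ g x (EuclideanSpace.single j 1) :=
      funext fun x => DD_apply j g x
    have hd : DifferentiableAt ℝ (fderiv ℝ g) x :=
      ((g.smooth 2).fderiv_right (m := 1) (by norm_num)).differentiable (by norm_num) x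
    rw [e, fderiv_clm_apply hd (differentiableAt_const _)]
    simp
  ext x
  rw [key, key]
  have := ContDiffAt.isSymmSndFDerivAt (𝕜 := ℝ) (f := g) (x := x) (n := 2)
    (g.smooth 2).contDiffAt (by simp)
  exact this _ _

/-- The Newton potential (without normalisation). -/
def UU (h : 𝓢(E3, ℝ)) : E3 → ℝ := TK (NK 0) h

lemma UU_fderiv (h : 𝓢(E3, ℝ)) (v : E3) (i : Fin 3) :
    fderiv ℝ (UU h) v (EuclideanSpace.single i 1) = UU (DD i h) v :=
  TK_fderiv_apply (NK_bound le_rfl) (NK_meas 0) h v i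

lemma UU_contDiff (h : 𝓢(E3, ℝ)) : ContDiff ℝ 1 (UU h) := TK_contDiff (NK_bound le_rfl) (NK_meas 0) h

lemma Wt_split (v y : E3) (hy : y ≠ 0) : Wt y * ((1 + ‖v + y‖) ^ 4)⁻¹ ≤
    4 * ((1 + ‖v + y‖) ^ 4)⁻¹ + 16 * GG y := by
  have hW := Wt_nonneg y
  have hG := GG_nonneg y
  have hp : 0 ≤ ((1 + ‖v + y‖) ^ 4)⁻¹ := by positivity
  rcases le_total 1 ‖y‖ with h | h
  · have : Wt y ≤ 4 := by
      unfold Wt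
      have : ‖y‖⁻¹ ≤ 1 := inv_le_one_of_one_le₀ h
      have h0 : 0 ≤ ‖y‖⁻¹ := by positivity
      nlinarith
    nlinarith
  · have h1 : ((1 + ‖v + y‖) ^ 4)⁻¹ ≤ 1 := by
      apply inv_le_one_of_one_le₀
      apply one_le_pow₀
      linarith [norm_nonneg (v + y)]
    have h2 : 1 ≤ 16 * ((1 + ‖y‖) ^ 4)⁻¹ := by
      rw [← div_eq_mul_inv, le_div_iff₀ (by positivity)]
      calc 1 * (1 + ‖y‖) ^ 4 ≤ 1 * (1 + 1) ^ 4 := by gcongr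
        _ = 16 := by norm_num
    have h3 : Wt y ≤ 16 * GG y := by
      unfold GG
      calc Wt y = Wt y * 1 := by ring
        _ ≤ Wt y * (16 * ((1 + ‖y‖) ^ 4)⁻¹) := by gcongr
        _ = _ := by ring
    nlinarith

lemma decay_pt {C δ : ℝ} (hC : 0 ≤ C) {h : E3 → ℝ} (hh : ∀ x, ‖h x‖ ≤ C * ((1 + ‖x‖) ^ 6)⁻¹)
    (hδ : 0 < δ) (i : Fin 3) (v y : E3) (hy : y ≠ 0) :
    ‖(-(y i * k1 0 (SS δ y))) • h (v + y)‖ ≤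
      ((1 + ‖v‖) ^ 2)⁻¹ * (C * (4 * ((1 + ‖v + y‖) ^ 4)⁻¹ + 16 * GG y)) := by
  have hs := SS_pos hδ y
  have hy0 := norm_pos_iff.2 hy
  have e2 : |k1 0 (SS δ y)| ≤ (SS δ y)⁻¹ ^ 3 := by simpa using k1_bound le_rfl hs
  have e3 : |-(y i * k1 0 (SS δ y))| ≤ (‖y‖ ^ 2)⁻¹ := by
    rw [abs_neg, abs_mul]
    calc |y i| * |k1 0 (SS δ y)| ≤ SS δ y * (SS δ y)⁻¹ ^ 3 := by
          gcongr
          exact abs_coord_le_SS δ y i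
      _ = (SS δ y)⁻¹ ^ 2 := by field_simp
      _ ≤ ‖y‖⁻¹ ^ 2 := by gcongr; exact SS_ge_norm δ y
      _ = _ := by rw [inv_pow]
  rw [norm_smul, Real.norm_eq_abs]
  calc _ ≤ (‖y‖ ^ 2)⁻¹ * (C * ((1 + ‖v + y‖) ^ 6)⁻¹) := by gcongr; exact hh _
    _ ≤ ((1 + ‖v‖) ^ 2)⁻¹ * (C * (Wt y * ((1 + ‖v + y‖) ^ 4)⁻¹)) := by
        have hp := peetre' v y
        have hv : 0 < 1 + ‖v‖ := by positivity
        have hvy : 0 < 1 + ‖v + y‖ := by positivity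
        have : (1 + ‖v‖) ^ 2 ≤ ((1 + ‖v + y‖) * (1 + ‖y‖)) ^ 2 := by gcongr
        have hWy : Wt y = (1 + ‖y‖) ^ 2 * (‖y‖ ^ 2)⁻¹ := by
          unfold Wt
          field_simp
          ring
        have e : ((1 + ‖v‖) ^ 2)⁻¹ * (C * (Wt y * ((1 + ‖v + y‖) ^ 4)⁻¹)) =
            ((((1 + ‖v + y‖) * (1 + ‖y‖)) ^ 2) * ((1 + ‖v‖) ^ 2)⁻¹) *
              ((‖y‖ ^ 2)⁻¹ * (C * ((1 + ‖v + y‖) ^ 6)⁻¹)) := by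
          rw [hWy]
          field_simp
        rw [e]
        refine le_mul_of_one_le_left (by positivity) ?_
        rw [← div_eq_mul_inv, le_div_iff₀ (by positivity), one_mul]
        exact this
    _ ≤ _ := by
        gcongr
        exact Wt_split v y hy

/-- Decay of derivatives of the Newton potential. -/
lemma UU_decay (i : Fin 3) (h : 𝓢(E3, ℝ)) :
    ∃ C, 0 ≤ C ∧ ∀ v, |UU (DD i h) v| ≤ C * ((1 + ‖v‖) ^ 2)⁻¹ := by
  obtain ⟨C, hC, hh⟩ := schwartz_bound h 6
  set J : ℝ := 4 * (∫ y : E3, ((1 + ‖y‖) ^ 4)⁻¹) + 16 * ∫ y, GG y with hJ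
  have hJ0 : 0 ≤ J := by
    have h1 : 0 ≤ ∫ y : E3, ((1 + ‖y‖) ^ 4)⁻¹ := integral_nonneg fun y => by positivity
    have h2 : 0 ≤ ∫ y, GG y := integral_nonneg GG_nonneg
    positivity
  refine ⟨C * J, by positivity, fun v => ?_⟩
  have t1 := TK_tendsto (k := NK 0) (kd := fun δ y => k0 0 (SS δ y)) (A := 1)
    (fun δ hδ y hy => k0_boundW le_rfl hδ hy) (fun δ hδ => (k_cont hδ 0).1.aestronglyMeasurable)
    (fun y hy => k0_tendsto 0 hy) (DD i h) v
  refine le_of_tendsto t1.abs ?_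
  filter_upwards [self_mem_nhdsWithin] with δ hδ
  have hδ : 0 < δ := hδ
  rw [ibp1 le_rfl hδ, abs_neg]
  have i4 : Integrable (fun y : E3 => ((1 + ‖v + y‖) ^ 4)⁻¹) := int4.comp_add_left v
  have iB : Integrable (fun y : E3 => 4 * ((1 + ‖v + y‖) ^ 4)⁻¹ + 16 * GG y) :=
    (i4.const_mul 4).add (GG_integrable.const_mul 16)
  have := norm_integral_le_of_norm_le ((iB.const_mul C).const_mul (((1 + ‖v‖) ^ 2)⁻¹))
    (by filter_upwards [ae_ne_zero] with y hy using decay_pt hC hh hδ i v y hy)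
  refine (this.trans (le_of_eq ?_))
  rw [integral_const_mul, integral_const_mul, integral_add (i4.const_mul 4)
    (GG_integrable.const_mul 16), integral_const_mul, integral_const_mul,
    integral_add_left_eq_self (fun y : E3 => ((1 + ‖y‖) ^ 4)⁻¹) v, ← hJ]
  ring

lemma UU_mul_integrable (p q : Fin 3) (a b : 𝓢(E3, ℝ)) :
    Integrable (fun v => UU (DD p a) v * UU (DD q b) v) := by
  obtain ⟨C, hC, h1⟩ := UU_decay p a
  obtain ⟨C', hC', h2⟩ := UU_decay q b
  refine (int4.const_mul (C * C')).mono' ?_ (ae_of_all _ fun v => ?_)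
  · exact ((UU_contDiff _).continuous.mul (UU_contDiff _).continuous).aestronglyMeasurable
  · rw [norm_mul, Real.norm_eq_abs, Real.norm_eq_abs]
    refine (mul_le_mul (h1 v) (h2 v) (abs_nonneg _) (by positivity)).trans (le_of_eq ?_)
    field_simp

lemma UU_ibp (i p q : Fin 3) (a b : 𝓢(E3, ℝ)) :
    ∫ v, UU (DD p a) v * UU (DD i (DD q b)) v = - ∫ v, UU (DD i (DD p a)) v * UU (DD q b) v := by
  have := integral_mul_fderiv_eq_neg_fderiv_mul_of_integrable (μ := (volume : Measure E3))
    (f := UU (DD p a)) (g := UU (DD q b)) (v := EuclideanSpace.single i 1)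
    (by simp only [UU_fderiv]; exact UU_mul_integrable _ _ _ _)
    (by simp only [UU_fderiv]; exact UU_mul_integrable _ _ _ _)
    (UU_mul_integrable _ _ _ _)
    (fun x _ => (UU_contDiff _).differentiable (by norm_num) x)
    (fun x _ => (UU_contDiff _).differentiable (by norm_num) x)
  simpa only [UU_fderiv] using this

lemma UU_sq (i j : Fin 3) (g : 𝓢(E3, ℝ)) :
    ∫ v, UU (DD i (DD j g)) v * UU (DD i (DD j g)) v =
      ∫ v, UU (DD j (DD j g)) v * UU (DD i (DD i g)) v := by
  have h1 := UU_ibp i j i g (DD j g)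
  have h2 := UU_ibp j j i g (DD i g)
  have e : DD i (DD i (DD j g)) = DD j (DD i (DD i g)) := by
    rw [DD_comm i j g, DD_comm i j]
  rw [e] at h1
  linarith

lemma UU_LL (g : 𝓢(E3, ℝ)) (v : E3) : ∑ i, UU (DD i (DD i g)) v = -(4 * Real.pi * g v) := by
  rw [← NK_LL]
  unfold UU TK
  rw [← integral_finsetSum _ fun i _ => TK_integrable (NK_bound le_rfl) (NK_meas 0) _ v]
  simp only [LL_apply, Finset.smul_sum]

lemma UU_sq_sum (g : 𝓢(E3, ℝ)) :
    ∑ i, ∑ j, ∫ v, UU (DD i (DD j g)) v ^ 2 = (4 * Real.pi) ^ 2 * ∫ v, g v ^ 2 := by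
  have e : ∀ i j, ∫ v, UU (DD i (DD j g)) v ^ 2 =
      ∫ v, UU (DD j (DD j g)) v * UU (DD i (DD i g)) v := by
    intro i j
    rw [← UU_sq]
    congr 1
    funext v
    ring
  simp only [e]
  have : ∀ i, ∑ j, ∫ v, UU (DD j (DD j g)) v * UU (DD i (DD i g)) v =
      ∫ v, ∑ j, UU (DD j (DD j g)) v * UU (DD i (DD i g)) v := fun i =>
    (integral_finsetSum _ fun j _ => UU_mul_integrable _ _ _ _).symm
  simp only [this]
  rw [← integral_finsetSum _ fun i _ => integrable_finsetSum _ fun j _ => UU_mul_integrable _ _ _ _,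
    ← integral_const_mul]
  congr 1
  funext v
  simp only [← Finset.sum_mul, UU_LL]
  rw [← Finset.mul_sum, UU_LL]
  ring

lemma UU_sq_le (i j : Fin 3) (g : 𝓢(E3, ℝ)) :
    ∫ v, UU (DD i (DD j g)) v ^ 2 ≤ (4 * Real.pi) ^ 2 * ∫ v, g v ^ 2 := by
  rw [← UU_sq_sum]
  have h0 : ∀ i j, 0 ≤ ∫ v, UU (DD i (DD j g)) v ^ 2 := fun i j =>
    integral_nonneg fun v => sq_nonneg _
  calc _ ≤ ∑ j, ∫ v, UU (DD i (DD j g)) v ^ 2 :=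
        Finset.single_le_sum (f := fun j => ∫ v, UU (DD i (DD j g)) v ^ 2) (fun j _ => h0 i j)
          (Finset.mem_univ j)
    _ ≤ _ := Finset.single_le_sum (f := fun i => ∑ j, ∫ v, UU (DD i (DD j g)) v ^ 2)
        (fun i _ => Finset.sum_nonneg fun j _ => h0 i j) (Finset.mem_univ i)

lemma UU_memLp (p : Fin 3) (a : 𝓢(E3, ℝ)) : MemLp (UU (DD p a)) 2 volume := by
  rw [memLp_two_iff_integrable_sq (UU_contDiff _).continuous.aestronglyMeasurable]
  simpa only [sq] using UU_mul_integrable p p a a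

lemma eLpNorm_two_sq {f : E3 → ℝ} (hf : MemLp f 2 volume) :
    eLpNorm f 2 volume = ENNReal.ofReal (Real.sqrt (∫ v, f v ^ 2)) := by
  rw [hf.eLpNorm_eq_integral_rpow_norm (by norm_num) (by norm_num), Real.sqrt_eq_rpow]
  simp

lemma UU_L2 (i j : Fin 3) (g : 𝓢(E3, ℝ)) :
    eLpNorm (UU (DD i (DD j g))) 2 volume ≤
      ENNReal.ofReal (4 * Real.pi) * eLpNorm g 2 volume := by
  rw [eLpNorm_two_sq (UU_memLp i _), eLpNorm_two_sq (g.memLp 2 volume),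
    ← ENNReal.ofReal_mul (by positivity)]
  apply ENNReal.ofReal_le_ofReal
  refine (Real.sqrt_le_sqrt (UU_sq_le i j g)).trans (le_of_eq ?_)
  rw [Real.sqrt_mul (by positivity), Real.sqrt_sq (by positivity)]

/-- The Sobolev constant. -/
def Ksob : NNReal := SNormLESNormFDerivOfEqConst ℝ (volume : Measure E3) 2

lemma sobolev_compact {f : E3 → ℝ} (hf : ContDiff ℝ 1 f) (hc : HasCompactSupport f) :
    eLpNorm f 6 volume ≤ Ksob * eLpNorm (fderiv ℝ f) 2 volume := by
  have := eLpNorm_le_eLpNorm_fderiv_of_eq (volume : Measure E3) hf hc (p := 2) (p' := 6)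
    (by norm_num) (by simp) (by simp; norm_num)
  exact_mod_cast this

lemma sobolev_L2 {f : E3 → ℝ} (hf : ContDiff ℝ 1 f) (h2 : MemLp f 2 volume) :
    eLpNorm f 6 volume ≤ Ksob * eLpNorm (fderiv ℝ f) 2 volume := by
  let χ : ContDiffBump (0 : E3) := ⟨1, 2, one_pos, one_lt_two⟩
  have hχ1 : ContDiff ℝ 1 (χ : E3 → ℝ) := χ.contDiff
  obtain ⟨M, hM⟩ := (hχ1.continuous_fderiv (by norm_num)).bounded_above_of_compact_support
    (χ.hasCompactSupport.fderiv (𝕜 := ℝ))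
  have hM0 : 0 ≤ M := (norm_nonneg _).trans (hM 0)
  let r : ℕ → ℝ := fun n => ((n : ℝ) + 1)⁻¹
  have hr : ∀ n, 0 < r n := fun n => by positivity
  have hr0 : Tendsto r atTop (𝓝 0) := by
    simpa [r, one_div] using tendsto_one_div_add_atTop_nhds_zero_nat (𝕜 := ℝ)
  let c : ℕ → E3 → ℝ := fun n x => χ (r n • x)
  have hcd : ∀ n, ContDiff ℝ 1 (c n) := fun n => hχ1.comp (contDiff_const_smul _)
  have hcs : ∀ n, HasCompactSupport (c n) := fun n =>
    χ.hasCompactSupport.comp_smul (hr n).ne'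
  have hcf : ∀ n x, ‖fderiv ℝ (c n) x‖ ≤ r n * M := by
    intro n x
    have h1 : HasFDerivAt (c n) ((fderiv ℝ χ (r n • x)).comp (r n • ContinuousLinearMap.id ℝ E3)) x :=
      (hχ1.differentiable (by norm_num) _).hasFDerivAt.comp x
        ((hasFDerivAt_id x).const_smul (r n))
    rw [h1.fderiv, ContinuousLinearMap.comp_smul, ContinuousLinearMap.comp_id, norm_smul,
      Real.norm_of_nonneg (hr n).le]
    exact mul_le_mul_of_nonneg_left (hM _) (hr n).le
  have hf2 : AEStronglyMeasurable (fderiv ℝ f) volume :=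
    (hf.continuous_fderiv (by norm_num)).aestronglyMeasurable
  have step : ∀ n, eLpNorm (fun x => c n x * f x) 6 volume ≤
      Ksob * (eLpNorm (fderiv ℝ f) 2 volume + ENNReal.ofReal (r n * M) * eLpNorm f 2 volume) := by
    intro n
    refine (sobolev_compact ((hcd n).mul hf) (hcs n).mul_right).trans ?_
    gcongr
    have hb : ∀ x, ‖fderiv ℝ (fun x => c n x * f x) x‖ ≤
        ‖fderiv ℝ f x‖ + (r n * M) * ‖f x‖ := by
      intro x
      rw [fderiv_fun_mul ((hcd n).differentiable (by norm_num) x) (hf.differentiable (by norm_num) x)]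
      refine (norm_add_le _ _).trans ?_
      rw [norm_smul, norm_smul]
      have h1 : ‖c n x‖ ≤ 1 := by
        rw [Real.norm_of_nonneg (χ.nonneg' _)]
        exact χ.le_one
      have := hcf n x
      have h3 := norm_nonneg (fderiv ℝ f x)
      have h4 := norm_nonneg (f x)
      nlinarith
    calc eLpNorm (fderiv ℝ (fun x => c n x * f x)) 2 volume
        ≤ eLpNorm (fun x => ‖fderiv ℝ f x‖ + (r n * M) * ‖f x‖) 2 volume :=
          eLpNorm_mono_real hb
      _ ≤ eLpNorm (fun x => ‖fderiv ℝ f x‖) 2 volume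
          + eLpNorm (fun x => (r n * M) * ‖f x‖) 2 volume :=
          eLpNorm_add_le hf2.norm (h2.1.norm.const_mul _) (by norm_num)
      _ = _ := by
          rw [eLpNorm_norm]
          congr 1
          have := eLpNorm_const_smul (r n * M) (fun x => ‖f x‖) 2 (volume : Measure E3)
          rw [eLpNorm_norm] at this
          rw [← ofReal_norm, Real.norm_of_nonneg (mul_nonneg (hr n).le hM0)] at this
          exact this
  have hlim : Tendsto (fun n => (Ksob : ℝ≥0∞) * (eLpNorm (fderiv ℝ f) 2 volume +
      ENNReal.ofReal (r n * M) * eLpNorm f 2 volume)) atTop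
      (𝓝 (Ksob * (eLpNorm (fderiv ℝ f) 2 volume + ENNReal.ofReal (0 * M) * eLpNorm f 2 volume))) := by
    refine ENNReal.Tendsto.const_mul (Tendsto.const_add _ ?_) (Or.inr ENNReal.coe_ne_top)
    refine ENNReal.Tendsto.mul_const ?_ (Or.inr h2.2.ne)
    exact ENNReal.tendsto_ofReal (hr0.mul_const M)
  have hF := Lp.eLpNorm_lim_le_liminf_eLpNorm (p := 6) (μ := (volume : Measure E3))
    (f := fun n x => c n x * f x)
    (fun n => ((hcd n).continuous.mul hf.continuous).aestronglyMeasurable) f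
    (ae_of_all _ fun x => by
      have h1 : Tendsto (fun n => c n x) atTop (𝓝 (χ ((0 : ℝ) • x))) :=
        (hχ1.continuous.tendsto _).comp (hr0.smul_const x)
      have h3 : χ ((0 : ℝ) • x) = 1 := by
        rw [zero_smul]
        exact χ.one_of_mem_closedBall (by simp [χ.rIn_pos.le])
      rw [h3] at h1
      simpa using h1.mul_const (f x))
  refine hF.trans ((liminf_le_liminf (Eventually.of_forall step)).trans ?_)
  rw [hlim.liminf_eq]
  simp

lemma clm_norm_le (L : E3 →L[ℝ] ℝ) : ‖L‖ ≤ ∑ j, ‖L (EuclideanSpace.single j 1)‖ := by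
  refine L.opNorm_le_bound (by positivity) fun x => ?_
  have hx : x = ∑ j, x j • EuclideanSpace.single j (1 : ℝ) := by
    ext k
    fin_cases k <;> simp [Fin.sum_univ_three]
  conv_lhs => rw [hx]
  rw [map_sum, Finset.sum_mul]
  refine (norm_sum_le _ _).trans (Finset.sum_le_sum fun j _ => ?_)
  rw [map_smul, norm_smul, mul_comm]
  gcongr
  exact abs_coord_le x j

lemma UU_L6 (i : Fin 3) (g : 𝓢(E3, ℝ)) :
    eLpNorm (UU (DD i g)) 6 volume ≤
      Ksob * (3 * (ENNReal.ofReal (4 * Real.pi) * eLpNorm g 2 volume)) := by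
  refine (sobolev_L2 (UU_contDiff _) (UU_memLp i g)).trans ?_
  gcongr
  calc eLpNorm (fderiv ℝ (UU (DD i g))) 2 volume
      ≤ eLpNorm (∑ j, fun v => ‖UU (DD j (DD i g)) v‖) 2 volume := by
        refine eLpNorm_mono_real fun v => ?_
        rw [Finset.sum_apply]
        refine (clm_norm_le _).trans (le_of_eq ?_)
        simp only [UU_fderiv]
    _ ≤ ∑ j, eLpNorm (fun v => ‖UU (DD j (DD i g)) v‖) 2 volume :=
        eLpNorm_sum_le (fun j _ => (UU_memLp j _).1.norm) (by norm_num)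
    _ ≤ ∑ j : Fin 3, ENNReal.ofReal (4 * Real.pi) * eLpNorm g 2 volume := by
        refine Finset.sum_le_sum fun j _ => ?_
        rw [eLpNorm_norm]
        exact UU_L2 j i g
    _ = _ := by simp

lemma pd_landaua_L6 (i : Fin 3) (g : 𝓢(E3, ℝ)) :
    eLpNorm (pd i (landaua g)) 6 volume ≤ 3 * Ksob * eLpNorm g 2 volume := by
  have e : pd i (landaua g) = (1 / (4 * Real.pi)) • UU (DD i g) := by
    funext v
    exact landaua_pd g i v
  rw [e, eLpNorm_const_smul, ← ofReal_norm, Real.norm_of_nonneg (by positivity)]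
  calc _ ≤ ENNReal.ofReal (1 / (4 * Real.pi)) *
        (Ksob * (3 * (ENNReal.ofReal (4 * Real.pi) * eLpNorm g 2 volume))) := by
        gcongr
        exact UU_L6 i g
    _ = (ENNReal.ofReal (1 / (4 * Real.pi)) * ENNReal.ofReal (4 * Real.pi)) *
        (3 * Ksob * eLpNorm g 2 volume) := by ring
    _ = _ := by
        rw [← ENNReal.ofReal_mul (by positivity), one_div,
          inv_mul_cancel₀ (by positivity), ENNReal.ofReal_one, one_mul]

lemma grad_L6 (g : 𝓢(E3, ℝ)) :
    eLpNorm (fun v => Real.sqrt (∑ i, (pd i (landaua g) v) ^ 2)) 6 volume ≤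
      ENNReal.ofReal (9 * Ksob + 1) * eLpNorm g 2 volume := by
  calc _ ≤ eLpNorm (∑ i, fun v => ‖pd i (landaua g) v‖) 6 volume := by
        refine eLpNorm_mono_real fun v => ?_
        rw [Finset.sum_apply, Real.norm_of_nonneg (Real.sqrt_nonneg _)]
        apply Real.sqrt_le_iff.2 ⟨by positivity, ?_⟩
        simp only [Fin.sum_univ_three, Real.norm_eq_abs]
        rw [← sq_abs (pd 0 _ v), ← sq_abs (pd 1 _ v), ← sq_abs (pd 2 _ v)]
        have h0 := abs_nonneg (pd 0 (landaua g) v)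
        have h1 := abs_nonneg (pd 1 (landaua g) v)
        have h2 := abs_nonneg (pd 2 (landaua g) v)
        nlinarith [mul_nonneg h0 h1, mul_nonneg h0 h2, mul_nonneg h1 h2]
    _ ≤ ∑ i, eLpNorm (fun v => ‖pd i (landaua g) v‖) 6 volume := by
        refine eLpNorm_sum_le (fun i _ => ?_) (by norm_num)
        have e : pd i (landaua g) = (1 / (4 * Real.pi)) • UU (DD i g) := by
          funext v
          exact landaua_pd g i v
        change AEStronglyMeasurable (fun v => ‖pd i (landaua g) v‖) volume
        rw [e]
        exact ((UU_contDiff _).continuous.const_smul _).norm.aestronglyMeasurable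
    _ ≤ ∑ i : Fin 3, 3 * Ksob * eLpNorm g 2 volume := by
        refine Finset.sum_le_sum fun i _ => ?_
        rw [eLpNorm_norm]
        exact pd_landaua_L6 i g
    _ = (9 * Ksob : ℝ≥0∞) * eLpNorm g 2 volume := by simp; ring
    _ ≤ _ := by
        gcongr
        rw [ENNReal.ofReal_add (by positivity) (by norm_num), ENNReal.ofReal_mul (by norm_num)]
        simp

/-- Proposition 3.1, identities (3.9) and bound (3.10): for Schwartz `w₀`,
`∇·A[w₀] = ∇a[w₀] = A₁ + ∇(𝓜w₀)` with `A₁ = ∇a[𝓜w₀]`, and `‖A₁‖_{L⁶} ≤ C‖𝓜w₀‖_{L²}`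
with a universal constant `C`. -/
theorem div_landau_matrix_decomposition :
    ∃ C > 0, ∀ w₀ : SchwartzMap (EuclideanSpace ℝ (Fin 3)) ℝ,
      (∀ v : EuclideanSpace ℝ (Fin 3), ∀ i : Fin 3,
        (∑ j, pd j (fun u => LandauA (⇑w₀) u i j) v) = pd i (landaua ⇑w₀) v ∧
        pd i (landaua ⇑w₀) v
          = pd i (landaua (besselM ⇑w₀)) v + pd i (besselM ⇑w₀) v) ∧
      eLpNorm (fun v => Real.sqrt (∑ i, (pd i (landaua (besselM ⇑w₀)) v) ^ 2)) 6 volume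
        ≤ ENNReal.ofReal C * eLpNorm (besselM ⇑w₀) 2 volume := by
  refine ⟨9 * Ksob + 1, by positivity, fun w => ?_⟩
  obtain ⟨g, hg⟩ := exists_bessel w
  rw [bessel_eq_g hg]
  exact ⟨fun v i => ⟨first_identity w i v, second_identity hg i v⟩, grad_L6 g⟩
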